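/- Non-stretchability of the crossing pattern: for every heptagon with vertices p_0, …, p_6 in clockwise convex position, it is impossible that all seven standardization lines ℓ_i (i ∈ ℤ/7ℤ) are +-crossing, and it is impossible that all seven are −-crossing. -/

import Mathlib

open Matrix

/-- Homogeneous coordinates of a point in the plane. -/
noncomputable def hat (p : Fin 2 → ℝ) : Fin 3 → ℝ := ![p 0, p 1, 1]

/-- Determinant of the 3×3 matrix with rows `u`, `v`, `w`. -/
def det3 (u v w : Fin 3 → ℝ) : ℝ := Matrix.det (Matrix.of ![u, v, w])

/-- The standardization point `p_i⁺`. -/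
noncomputable def pplus (p : Fin 7 → Fin 2 → ℝ) (i : Fin 7) : Fin 3 → ℝ :=
  crossProduct (crossProduct (hat (p (i + 1))) (hat (p (i + 2))))
    (crossProduct (hat (p i)) (hat (p (i + 3))))

/-- The standardization point `p_i⁻`. -/
noncomputable def pminus (p : Fin 7 → Fin 2 → ℝ) (i : Fin 7) : Fin 3 → ℝ :=
  crossProduct (crossProduct (hat (p (i - 1))) (hat (p (i - 2))))
    (crossProduct (hat (p i)) (hat (p (i - 3))))

/-- The `i`-th standardization line `ℓ_i` (in homogeneous line coordinates). -/
noncomputable def sline (p : Fin 7 → Fin 2 → ℝ) (i : Fin 7) : Fin 3 → ℝ :=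
  crossProduct (pplus p i) (pminus p i)

/-- The line `ℓ_i` is `+`-crossing: it separates `p_{i+1}` and `p_{i+2}` from the
remaining vertices of the heptagon. -/
noncomputable def IsPlusCrossing (p : Fin 7 → Fin 2 → ℝ) (i : Fin 7) : Prop :=
  ∃ ε : ℝ, (ε = 1 ∨ ε = -1) ∧
    0 ≤ ε * (sline p i ⬝ᵥ hat (p (i + 1))) ∧
    0 ≤ ε * (sline p i ⬝ᵥ hat (p (i + 2))) ∧
    ∀ j : Fin 7, j ≠ i + 1 → j ≠ i + 2 → ε * (sline p i ⬝ᵥ hat (p j)) < 0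

/-- The line `ℓ_i` is `−`-crossing: it separates `p_{i−1}` and `p_{i−2}` from the
remaining vertices of the heptagon. -/
noncomputable def IsMinusCrossing (p : Fin 7 → Fin 2 → ℝ) (i : Fin 7) : Prop :=
  ∃ ε : ℝ, (ε = 1 ∨ ε = -1) ∧
    0 ≤ ε * (sline p i ⬝ᵥ hat (p (i - 1))) ∧
    0 ≤ ε * (sline p i ⬝ᵥ hat (p (i - 2))) ∧
    ∀ j : Fin 7, j ≠ i - 1 → j ≠ i - 2 → ε * (sline p i ⬝ᵥ hat (p j)) < 0

theorem cross_cross_eq_smul_sub (a b c e : Fin 3 → ℝ) :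
    crossProduct (crossProduct a b) (crossProduct c e) =
      det3 a b e • c - det3 a b c • e := by
  ext k
  fin_cases k <;> simp [cross_apply, det3, Matrix.det_fin_three] <;> ring

theorem cross_smul_sub_dotProduct (a b c x : Fin 3 → ℝ) (r s t u : ℝ) :
    crossProduct (r • a - s • b) (t • a - u • c) ⬝ᵥ x =
      -(r * u) * det3 a c x + s * t * det3 a b x + s * u * det3 b c x := by
  simp [cross_apply, det3, Matrix.det_fin_three, dotProduct, Fin.sum_univ_three]
  ring

theorem det3_rotate (a b c : Fin 3 → ℝ) : det3 b c a = det3 a b c := by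
  simp [det3, Matrix.det_fin_three]
  ring

theorem det3_swap (a b c : Fin 3 → ℝ) : det3 b a c = -det3 a b c := by
  simp [det3, Matrix.det_fin_three]
  ring

theorem det3_self_right (a b : Fin 3 → ℝ) : det3 a b b = 0 := by
  simp [det3, Matrix.det_fin_three]
  ring

/-- The three-term Grassmann–Plücker relation. -/
theorem det3_mul_det3 (a b c e f : Fin 3 → ℝ) :
    det3 a b e * det3 a c f = det3 a b c * det3 a e f + det3 a b f * det3 a c e := by
  simp [det3, Matrix.det_fin_three]
  ring

theorem cyclic_order_add (i a b c : Fin 7) (hab : a < b) (hbc : b < c) :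
    (i + a < i + b ∧ i + b < i + c) ∨ (i + b < i + c ∧ i + c < i + a) ∨
      (i + c < i + a ∧ i + a < i + b) := by
  omega

/-- The sign of the triangles of a heptagon in convex position is invariant under rotation of
the labels. -/
theorem det3_pos_add {v : Fin 7 → Fin 3 → ℝ} {s : ℝ}
    (h : ∀ i j k : Fin 7, i < j → j < k → 0 < s * det3 (v i) (v j) (v k))
    (i a b c : Fin 7) (hab : a < b) (hbc : b < c) :
    0 < s * det3 (v (i + a)) (v (i + b)) (v (i + c)) := by
  rcases cyclic_order_add i a b c hab hbc with ⟨h₁, h₂⟩ | ⟨h₁, h₂⟩ | ⟨h₁, h₂⟩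
  · exact h _ _ _ h₁ h₂
  · rw [← det3_rotate]
    exact h _ _ _ h₁ h₂
  · rw [← det3_rotate, ← det3_rotate]
    exact h _ _ _ h₁ h₂

/-- Multiplying each family of inequalities over a full rotation is contradictory. -/
theorem false_of_cyclic_inequalities {X U V W Y : Fin 7 → ℝ}
    (hX : ∀ i, 0 < X i) (hU : ∀ i, 0 < U i) (hV : ∀ i, 0 < V i) (hW : ∀ i, 0 < W i)
    (hY : ∀ i, 0 < Y i)
    (hWU : ∀ i, X (i + 1) * X (i + 5) * W i < X i * X (i + 4) * U i)
    (hVU : ∀ i, X i * X (i + 5) * V (i + 1) < X i * X (i + 4) * U i)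
    (hYV : ∀ i, X (i + 1) * X (i + 5) * Y i < X i * X (i + 4) * V i)
    (hUU : ∀ i, U i * U (i + 4) < W i * Y (i + 3)) : False := by
  have shift (f : Fin 7 → ℝ) (a : Fin 7) : ∏ i, f (i + a) = ∏ i, f i :=
    Equiv.prod_comp (Equiv.addRight a) f
  have prod_lt {f g : Fin 7 → ℝ} (hf : ∀ i, 0 < f i) (hfg : ∀ i, f i < g i) :
      ∏ i, f i < ∏ i, g i :=
    Finset.prod_lt_prod_of_nonempty (fun i _ => hf i) (fun i _ => hfg i) Finset.univ_nonempty
  have h₁ := prod_lt (fun i => mul_pos (mul_pos (hX _) (hX _)) (hW _)) hWU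
  have h₂ := prod_lt (fun i => mul_pos (mul_pos (hX _) (hX _)) (hV _)) hVU
  have h₃ := prod_lt (fun i => mul_pos (mul_pos (hX _) (hX _)) (hY _)) hYV
  have h₄ := prod_lt (fun i => mul_pos (hU _) (hU _)) hUU
  simp only [Finset.prod_mul_distrib, shift] at h₁ h₂ h₃ h₄
  have pX : 0 < ∏ i, X i := Finset.prod_pos fun i _ => hX i
  have pY : 0 < ∏ i, Y i := Finset.prod_pos fun i _ => hY i
  have pXX := (mul_pos pX pX).le
  have h₅ := lt_of_mul_lt_mul_left h₁ pXX
  have h₆ := (lt_of_mul_lt_mul_left h₃ pXX).trans (lt_of_mul_lt_mul_left h₂ pXX)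
  exact lt_asymm h₄ (mul_lt_mul'' h₅ h₆ (Finset.prod_nonneg fun i _ => (hW i).le) pY.le)

/-- `IsPlusCrossing` fails for some line of a heptagon in convex position, whichever its
orientation `s`. -/
theorem not_forall_isPlusCrossing {p : Fin 7 → Fin 2 → ℝ} {s : ℝ} (hs : s = 1 ∨ s = -1)
    (h : ∀ i j k : Fin 7, i < j → j < k → 0 < s * det3 (hat (p i)) (hat (p j)) (hat (p k))) :
    ¬ ∀ i : Fin 7, IsPlusCrossing p i := by
  intro hc
  have hss : s * s = 1 := by rcases hs with rfl | rfl <;> norm_num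
  let d (i j k : Fin 7) : ℝ := s * det3 (hat (p i)) (hat (p j)) (hat (p k))
  have rot (i j k : Fin 7) : d j k i = d i j k := by simp only [d, det3_rotate]
  have swap (i j k : Fin 7) : d j i k = -d i j k := by
    simp only [d, det3_swap (hat (p i))]
    ring
  have swap_right (i j k : Fin 7) : d i k j = -d i j k := by
    rw [← rot i k j, swap j k i, rot i j k]
  have self (i j : Fin 7) : d i j j = 0 := by simp only [d, det3_self_right, mul_zero]
  have pos (i a b c : Fin 7) (hab : a < b) (hbc : b < c) : 0 < d (i + a) (i + b) (i + c) :=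
    det3_pos_add (v := fun i => hat (p i)) h i a b c hab hbc
  have pos₀ (i b c : Fin 7) (hb : 0 < b) (hbc : b < c) : 0 < d i (i + b) (i + c) := by
    simpa using pos i 0 b c hb hbc
  have line (i j : Fin 7) : s * (sline p i ⬝ᵥ hat (p j)) =
      d (i + 1) (i + 2) (i + 3) * d (i + 5) (i + 6) i * d i (i + 4) j
        - d i (i + 1) (i + 2) * d (i + 4) (i + 5) (i + 6) * d i (i + 3) j
        - d i (i + 1) (i + 2) * d (i + 5) (i + 6) i * d (i + 3) (i + 4) j := by
    have e₁ : i - 1 = i + 6 := by omega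
    have e₂ : i - 2 = i + 5 := by omega
    have e₃ : i - 3 = i + 4 := by omega
    have c₁ : d (i + 4) (i + 5) (i + 6) = - d (i + 6) (i + 5) (i + 4) := by
      rw [← rot, swap]
    have c₂ : d (i + 5) (i + 6) i = - d (i + 6) (i + 5) i := swap _ _ _
    rw [sline, pplus, pminus, e₁, e₂, e₃, cross_cross_eq_smul_sub (hat (p (i + 1))),
      cross_cross_eq_smul_sub (hat (p (i + 6))), cross_smul_sub_dotProduct, c₁, c₂,
      ← rot i (i + 1) (i + 2)]
    simp only [d]
    linear_combination (-s * (
      -(det3 (hat (p (i + 1))) (hat (p (i + 2))) (hat (p (i + 3))) *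
        det3 (hat (p (i + 6))) (hat (p (i + 5))) (hat (p i))) *
          det3 (hat (p i)) (hat (p (i + 4))) (hat (p j)) +
      det3 (hat (p (i + 1))) (hat (p (i + 2))) (hat (p i)) *
        det3 (hat (p (i + 6))) (hat (p (i + 5))) (hat (p (i + 4))) *
          det3 (hat (p i)) (hat (p (i + 3))) (hat (p j)) +
      det3 (hat (p (i + 1))) (hat (p (i + 2))) (hat (p i)) *
        det3 (hat (p (i + 6))) (hat (p (i + 5))) (hat (p i)) *
          det3 (hat (p (i + 3))) (hat (p (i + 4))) (hat (p j)))) * hss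
  have crossing (i : Fin 7) : 0 ≤ s * (sline p i ⬝ᵥ hat (p (i + 1))) ∧
      0 ≤ s * (sline p i ⬝ᵥ hat (p (i + 2))) := by
    obtain ⟨ε, hε, h₁, h₂, hj⟩ := hc i
    have h₀ : ε * (sline p i ⬝ᵥ hat (p i)) < 0 := hj i (by omega) (by omega)
    have hneg : s * (sline p i ⬝ᵥ hat (p i)) < 0 := by
      have c₁ : d i (i + 4) i = 0 := by rw [← rot, self]
      have c₂ : d i (i + 3) i = 0 := by rw [← rot, self]
      rw [line, c₁, c₂, rot i (i + 3) (i + 4)]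
      have a₁ := pos₀ i 1 2 (by decide) (by decide)
      have a₂ := pos₀ i 5 6 (by decide) (by decide)
      have a₃ := pos₀ i 3 4 (by decide) (by decide)
      rw [← rot] at a₂
      linarith [mul_pos (mul_pos a₁ a₂) a₃]
    have : ε = s := by
      rcases hε with rfl | rfl <;> rcases hs with rfl | rfl <;> first | rfl | linarith
    exact this ▸ ⟨h₁, h₂⟩
  have gp (i : Fin 7) : d i (i + 1) (i + 4) * d i (i + 3) (i + 5) =
      d i (i + 1) (i + 3) * d i (i + 4) (i + 5) + d i (i + 1) (i + 5) * d i (i + 3) (i + 4) := by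
    linear_combination s * s * det3_mul_det3 (hat (p i)) (hat (p (i + 1))) (hat (p (i + 3)))
      (hat (p (i + 4))) (hat (p (i + 5)))
  have pX (i : Fin 7) : 0 < d i (i + 1) (i + 2) := pos₀ i 1 2 (by decide) (by decide)
  have pU (i : Fin 7) : 0 < d i (i + 1) (i + 3) := pos₀ i 1 3 (by decide) (by decide)
  have pV (i : Fin 7) : 0 < d i (i + 2) (i + 3) := pos₀ i 2 3 (by decide) (by decide)
  have pW (i : Fin 7) : 0 < d i (i + 1) (i + 4) := pos₀ i 1 4 (by decide) (by decide)
  have pY (i : Fin 7) : 0 < d i (i + 2) (i + 4) := pos₀ i 2 4 (by decide) (by decide)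
  have shift (i a b c : Fin 7) : d (i + a) (i + a + b) (i + a + c) =
      d (i + a) (i + (a + b)) (i + (a + c)) := by simp only [add_assoc]
  have X₁ (i : Fin 7) := shift i 1 1 2
  have X₂ (i : Fin 7) := shift i 2 1 2
  have X₄ (i : Fin 7) := shift i 4 1 2
  have X₅ (i : Fin 7) := shift i 5 1 2
  have V₁ (i : Fin 7) := shift i 1 2 3
  have Y₃ (i : Fin 7) := shift i 3 2 4
  have U₄ (i : Fin 7) := shift i 4 1 3
  simp only [Fin.reduceAdd, add_zero] at X₁ X₂ X₄ X₅ V₁ Y₃ U₄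
  have at₁ (i : Fin 7) := (crossing i).1
  have at₂ (i : Fin 7) := (crossing i).2
  simp only [line, rot (_ + 1) (_ + 3) (_ + 4)] at at₁
  simp only [line, rot (_ + 2) (_ + 3) (_ + 4)] at at₂
  simp only [swap_right _ (_ + 1) (_ + 4), swap_right _ (_ + 1) (_ + 3)] at at₁
  simp only [swap_right _ (_ + 2) (_ + 4), swap_right _ (_ + 2) (_ + 3)] at at₂
  refine false_of_cyclic_inequalities pX pU pV pW pY (fun i => ?_) (fun i => ?_) (fun i => ?_)
    (fun i => ?_)
  · rw [X₁, X₅, X₄]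
    have hpos := mul_pos (mul_pos (pX i) (pX (i + 5))) (pV (i + 1))
    rw [X₅, V₁] at hpos
    linarith [at₁ i]
  · rw [X₅, X₄, V₁]
    have hpos := mul_pos (mul_pos (pX (i + 1)) (pX (i + 5))) (pW i)
    rw [X₁, X₅] at hpos
    linarith [at₁ i]
  · rw [X₁, X₅, X₄]
    have hpos := mul_pos (mul_pos (pX i) (pX (i + 5))) (pX (i + 2))
    rw [X₅, X₂] at hpos
    linarith [at₂ i]
  · rw [U₄, Y₃, rot i, rot i]
    have hpos := mul_pos (pos₀ i 1 5 (by decide) (by decide)) (pos₀ i 3 4 (by decide) (by decide))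
    linarith [gp i]

/-- Non-stretchability: no heptagon has all seven standardization lines `+`-crossing,
and none has all seven `−`-crossing. -/
theorem not_all_crossing
    (p : Fin 7 → Fin 2 → ℝ)
    (hconv : ∀ i j k : Fin 7, i < j → j < k →
      det3 (hat (p i)) (hat (p j)) (hat (p k)) < 0) :
    ¬ (∀ i : Fin 7, IsPlusCrossing p i) ∧ ¬ (∀ i : Fin 7, IsMinusCrossing p i) := by
  constructor
  · refine not_forall_isPlusCrossing (s := -1) (Or.inr rfl) fun i j k hij hjk => ?_
    linarith [hconv i j k hij hjk]
  · intro hc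
    refine not_forall_isPlusCrossing (p := fun i => p (-i)) (s := 1) (Or.inl rfl)
      (fun i j k hij hjk => ?_) fun i => ?_
    · rw [one_mul, ← neg_neg (det3 _ _ _), ← det3_swap]
      have order : -k < -j ∧ -j < -i ∨ -i < -k ∧ -k < -j := by
        revert i j k
        decide
      rcases order with ⟨h₁, h₂⟩ | ⟨h₁, h₂⟩
      · rw [← det3_rotate, ← det3_rotate]
        linarith [hconv _ _ _ h₁ h₂]
      · rw [← det3_rotate]
        linarith [hconv _ _ _ h₁ h₂]
    · have e (a : Fin 7) : -i - a = -(i + a) := by abel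
      have e' (a : Fin 7) : -(i - a) = -i + a := by abel
      have hline : sline (fun i => p (-i)) i = -sline p (-i) := by
        simp only [sline, pplus, pminus, e, e', cross_anticomm]
      obtain ⟨ε, hε, h₁, h₂, hj⟩ := hc (-i)
      refine ⟨-ε, ?_, ?_, ?_, fun j hj₁ hj₂ => ?_⟩
      · rcases hε with rfl | rfl <;> simp
      · simpa [hline, e] using h₁
      · simpa [hline, e] using h₂
      · have := hj (-j) (by rwa [e, Ne, neg_inj]) (by rwa [e, Ne, neg_inj])
        simpa [hline] using this
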